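/- Let A, B, C, D be real matrices of sizes n×n, n×m, p×n, p×m respectively, let Q be a symmetric negative definite p×p real matrix, S a p×m real matrix, R a symmetric m×m real matrix, and let P and P̃ be symmetric positive definite n×n real matrices. Suppose the convexified constraint holds: the 4×4 block matrix [[−P, −CᵀS, Cᵀ, Aᵀ], [−SᵀC, −DᵀS − SᵀD − R, Dᵀ, Bᵀ], [C, D, Q⁻¹, 0], [A, B, 0, −2P̃⁻¹ + P̃⁻¹ P P̃⁻¹]] is negative semidefinite. Then the discrete LTI system x_{k+1} = A x_k + B u_k, y_k = C x_k + D u_k is QSR-dissipative in the sense that for every input sequence u : ℕ → ℝ^m, every state trajectory x : ℕ → ℝ^n, and every T ∈ ℕ, Σ_{k=0}^{T} ( y_kᵀ Q y_k + 2 y_kᵀ S u_k + u_kᵀ R u_k ) ≥ −x₀ᵀ P x₀. -/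

import Mathlib

open Matrix

lemma dotProduct_transpose_mulVec_eq {k l : Type*} [Fintype k] [Fintype l] (M : Matrix k l ℝ)
    (v : l → ℝ) (w : k → ℝ) : v ⬝ᵥ Mᵀ *ᵥ w = (M *ᵥ v) ⬝ᵥ w := by
  rw [dotProduct_mulVec, vecMul_transpose]

/-- The quadratic form of the convexified block constraint at the vector `(x, u, a, b)`. -/
lemma convexified_quadratic_form_nonneg {n m p : Type*} [Fintype n] [Fintype m] [Fintype p]
    {A : Matrix n n ℝ} {B : Matrix n m ℝ} {C : Matrix p n ℝ} {D : Matrix p m ℝ}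
    {S : Matrix p m ℝ} {R : Matrix m m ℝ} {P W : Matrix n n ℝ} {V : Matrix p p ℝ}
    (h : (-(fromBlocks
        (fromBlocks (-P) (-(Cᵀ * S)) (-(Sᵀ * C)) (-(Dᵀ * S) - Sᵀ * D - R))
        (fromBlocks Cᵀ Aᵀ Dᵀ Bᵀ) (fromBlocks C D A B) (fromBlocks V 0 0 W))).PosSemidef)
    (x : n → ℝ) (u : m → ℝ) (a : p → ℝ) (b : n → ℝ) :
    0 ≤ x ⬝ᵥ P *ᵥ x + 2 * ((C *ᵥ x + D *ᵥ u) ⬝ᵥ S *ᵥ u) + u ⬝ᵥ R *ᵥ u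
      - 2 * ((C *ᵥ x + D *ᵥ u) ⬝ᵥ a) - a ⬝ᵥ V *ᵥ a
      - 2 * ((A *ᵥ x + B *ᵥ u) ⬝ᵥ b) - b ⬝ᵥ W *ᵥ b := by
  have key := h.dotProduct_mulVec_nonneg (Sum.elim (Sum.elim x u) (Sum.elim a b))
  simp only [star_trivial, neg_mulVec, fromBlocks_mulVec, Sum.elim_comp_inl, Sum.elim_comp_inr,
    dotProduct_neg, sumElim_dotProduct_sumElim, dotProduct_add, sub_mulVec,
    dotProduct_sub, ← mulVec_mulVec, zero_mulVec, dotProduct_zero, ← Sum.elim_add_add] at key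
  simp only [dotProduct_transpose_mulVec_eq] at key
  simp only [add_dotProduct]
  linarith [dotProduct_comm (S *ᵥ u) (C *ᵥ x), dotProduct_comm (S *ᵥ u) (D *ᵥ u),
    dotProduct_comm a (C *ᵥ x), dotProduct_comm a (D *ᵥ u),
    dotProduct_comm b (A *ᵥ x), dotProduct_comm b (B *ᵥ u)]

/-- Dissipativity guarantee of the convexified LMI constraint: any system
`(A, B, C, D)` feasible for the convexified 4×4 block constraint (with the
block `−P⁻¹` replaced by its overbound `−2P̃⁻¹ + P̃⁻¹PP̃⁻¹`) satisfies the
QSR dissipation inequality along all of its trajectories. -/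
theorem convexified_constraint_implies_dissipativity {n m p : ℕ}
    (A : Matrix (Fin n) (Fin n) ℝ) (B : Matrix (Fin n) (Fin m) ℝ)
    (C : Matrix (Fin p) (Fin n) ℝ) (D : Matrix (Fin p) (Fin m) ℝ)
    (Q : Matrix (Fin p) (Fin p) ℝ) (S : Matrix (Fin p) (Fin m) ℝ)
    (R : Matrix (Fin m) (Fin m) ℝ)
    (hQ : (-Q).PosDef) (hR : R.IsSymm)
    (P Pt : Matrix (Fin n) (Fin n) ℝ) (hP : P.PosDef) (hPt : Pt.PosDef)
    (hconv : (-(Matrix.fromBlocks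
        (Matrix.fromBlocks (-P) (-(Cᵀ * S)) (-(Sᵀ * C)) (-(Dᵀ * S) - Sᵀ * D - R))
        (Matrix.fromBlocks Cᵀ Aᵀ Dᵀ Bᵀ)
        (Matrix.fromBlocks C D A B)
        (Matrix.fromBlocks Q⁻¹ 0 0
          (-((2 : ℝ) • Pt⁻¹) + Pt⁻¹ * P * Pt⁻¹)))).PosSemidef)
    (u : ℕ → Fin m → ℝ) (x : ℕ → Fin n → ℝ) (y : ℕ → Fin p → ℝ)
    (hx : ∀ k, x (k + 1) = A *ᵥ x k + B *ᵥ u k)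
    (hy : ∀ k, y k = C *ᵥ x k + D *ᵥ u k) (T : ℕ) :
    ∑ k ∈ Finset.range (T + 1),
        (y k ⬝ᵥ Q *ᵥ y k + 2 * (y k ⬝ᵥ S *ᵥ u k) + u k ⬝ᵥ R *ᵥ u k) ≥
      -(x 0 ⬝ᵥ P *ᵥ x 0) := by
  have step : ∀ k, x (k + 1) ⬝ᵥ P *ᵥ x (k + 1) - x k ⬝ᵥ P *ᵥ x k ≤
      y k ⬝ᵥ Q *ᵥ y k + 2 * (y k ⬝ᵥ S *ᵥ u k) + u k ⬝ᵥ R *ᵥ u k := by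
    intro k
    have hQdet : IsUnit Q.det := by
      rw [← isUnit_iff_isUnit_det]
      simpa using hQ.isUnit.neg
    have hPtdet : IsUnit Pt.det := (isUnit_iff_isUnit_det Pt).mp hPt.isUnit
    have hPtsymm : Ptᵀ = Pt := by simpa using hPt.isHermitian.eq
    have key := convexified_quadratic_form_nonneg hconv (x k) (u k)
      (-(Q *ᵥ y k)) (Pt *ᵥ x (k + 1))
    rw [← hx, ← hy] at key
    have hQform : (-(Q *ᵥ y k)) ⬝ᵥ Q⁻¹ *ᵥ (-(Q *ᵥ y k)) = y k ⬝ᵥ Q *ᵥ y k := by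
      rw [mulVec_neg, neg_dotProduct_neg, mulVec_mulVec, nonsing_inv_mul _ hQdet, one_mulVec,
        dotProduct_comm]
    have hPtinv : Pt⁻¹ *ᵥ (Pt *ᵥ x (k + 1)) = x (k + 1) := by
      rw [mulVec_mulVec, nonsing_inv_mul _ hPtdet, one_mulVec]
    have hPtform : ∀ w, (Pt *ᵥ x (k + 1)) ⬝ᵥ Pt⁻¹ *ᵥ w = x (k + 1) ⬝ᵥ w := by
      intro w
      rw [← vecMul_transpose, hPtsymm, ← dotProduct_mulVec, mulVec_mulVec,
        mul_nonsing_inv _ hPtdet, one_mulVec]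
    rw [hQform] at key
    simp only [add_mulVec, neg_mulVec, smul_mulVec, ← mulVec_mulVec, hPtinv, dotProduct_add,
      dotProduct_neg, dotProduct_smul, hPtform, smul_eq_mul] at key
    linarith [dotProduct_comm (Pt *ᵥ x (k + 1)) (x (k + 1))]
  have hsum := Finset.sum_le_sum fun k (_ : k ∈ Finset.range (T + 1)) => step k
  rw [Finset.sum_range_sub (fun k => x k ⬝ᵥ P *ᵥ x k)] at hsum
  have hfinal : 0 ≤ x (T + 1) ⬝ᵥ P *ᵥ x (T + 1) := by
    simpa using hP.posSemidef.dotProduct_mulVec_nonneg (x (T + 1))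
  linarith
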